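/- Let q be an odd prime power with q ≥ 5, let G = PGL₂(𝔽_q), and let ε = 1 if q ≡ 1 (mod 4) and ε = −1 if q ≡ 3 (mod 4), so that 4 divides q − ε. Suppose: i ∈ G is an involution and T ≤ C_G(i) is a cyclic subgroup of cardinality q − ε; j ∈ G is an involution satisfying j⁻¹·t·j = t⁻¹ for all t ∈ T, whose centralizer C_G(j) has cardinality 2(q − ε); x ∈ G has order 3 and satisfies x⁻¹·i·x = i·j and x⁻¹·j·x = i; and s ∈ T has order 4. Then the subgroup of G generated by {i, j, x, s} is isomorphic to the symmetric group on 4 letters. -/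

import Mathlib

open Matrix

/-- `PGL₂(F)`: the quotient of `GL₂(F)` by its center. -/
abbrev PGL2 (F : Type*) [Field F] : Type _ :=
  GL (Fin 2) F ⧸ Subgroup.center (GL (Fin 2) F)

theorem exists_smul_eq_of_commute_of_trace_eq_zero {F : Type*} [Field F] (h2 : (2 : F) ≠ 0)
    {A B : Matrix (Fin 2) (Fin 2) F} (hA : A.trace = 0) (hB : B.trace = 0) (hB0 : B ≠ 0)
    (h : A * B = B * A) : ∃ r : F, A = r • B := by
  rw [Matrix.trace_fin_two] at hA hB
  have e00 := congrFun₂ h 0 0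
  have e01 := congrFun₂ h 0 1
  have e10 := congrFun₂ h 1 0
  simp only [Matrix.mul_apply, Fin.sum_univ_two] at e00 e01 e10
  have hA' : A 1 1 = - A 0 0 := by linear_combination hA
  have hB' : B 1 1 = - B 0 0 := by linear_combination hB
  rw [hA', hB'] at e01 e10
  have h1 : A 0 0 * B 0 1 = A 0 1 * B 0 0 := by
    apply mul_left_cancel₀ h2; linear_combination e01
  have h3 : A 0 0 * B 1 0 = A 1 0 * B 0 0 := by
    apply mul_left_cancel₀ h2; linear_combination -e10
  have key (a b : Fin 2) (hab : B a b ≠ 0) : ∃ r : F, A = r • B := by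
    refine ⟨A a b / B a b, ?_⟩
    ext c d
    rw [Matrix.smul_apply, smul_eq_mul, div_mul_eq_mul_div, eq_div_iff hab]
    fin_cases a <;> fin_cases b <;> fin_cases c <;> fin_cases d <;>
      simp only [Fin.zero_eta, Fin.mk_one, hA', hB'] <;> grind
  by_contra! hr
  apply hB0
  ext a b
  by_contra hab
  obtain ⟨r, hr'⟩ := key a b hab
  exact hr r hr'

theorem commute_mul_of_anticommute {R : Type*} [Ring R] {a b c : R}
    (ha : a * c = -(c * a)) (hb : b * c = -(c * b)) : Commute (a * b) c := by
  rw [commute_iff_eq, mul_assoc, hb, mul_neg, ← mul_assoc, ha, neg_mul, neg_neg, mul_assoc]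

theorem PGL2.mk_eq_mk_iff {F : Type*} [Field F] {A B : GL (Fin 2) F} :
    (A : PGL2 F) = B ↔ ∃ r : F, A.val = r • B.val := by
  rw [eq_comm, QuotientGroup.eq, Matrix.GeneralLinearGroup.mem_center_iff_val_mem_range_scalar]
  refine exists_congr fun r => ?_
  rw [Units.val_mul, eq_comm (a := Matrix.scalar (Fin 2) r), Units.inv_mul_eq_iff_eq_mul,
    Matrix.scalar_apply, ← Matrix.smul_eq_mul_diagonal]

theorem PGL2.mk_eq_one_iff {F : Type*} [Field F] {A : GL (Fin 2) F} :
    (A : PGL2 F) = 1 ↔ ∃ r : F, A.val = r • (1 : Matrix (Fin 2) (Fin 2) F) :=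
  PGL2.mk_eq_mk_iff (B := 1)

theorem PGL2.trace_eq_zero_of_orderOf_eq_two {F : Type*} [Field F] {A : GL (Fin 2) F}
    (h : orderOf (A : PGL2 F) = 2) : A.val.trace = 0 := by
  have hsq : ((A * A : GL (Fin 2) F) : PGL2 F) = 1 := by
    rw [QuotientGroup.mk_mul, ← pow_two]
    exact orderOf_dvd_iff_pow_eq_one.1 h.dvd
  obtain ⟨r, hr⟩ := PGL2.mk_eq_one_iff.1 hsq
  by_contra htr
  have hA1 : (A : PGL2 F) = 1 := by
    refine PGL2.mk_eq_one_iff.2 ⟨(r + A.val.det) / A.val.trace, ?_⟩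
    rw [div_eq_inv_mul, mul_smul, eq_inv_smul_iff₀ htr, add_smul, ← hr, Units.val_mul]
    ext a b
    fin_cases a <;> fin_cases b <;>
      simp [Matrix.trace_fin_two, Matrix.det_fin_two, Matrix.mul_apply] <;> ring
  rw [hA1, orderOf_one] at h
  exact absurd h (by norm_num)

theorem PGL2.mul_eq_or_mul_eq_neg {F : Type*} [Field F] {A B : GL (Fin 2) F}
    (h : (A : PGL2 F) * B = B * A) :
    A.val * B.val = B.val * A.val ∨ A.val * B.val = - (B.val * A.val) := by
  rw [← QuotientGroup.mk_mul, ← QuotientGroup.mk_mul] at h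
  obtain ⟨r, hr⟩ := PGL2.mk_eq_mk_iff.1 h
  rw [Units.val_mul, Units.val_mul] at hr
  have hdet := congrArg Matrix.det hr
  have hA : A.val.det ≠ 0 := ((Matrix.isUnit_iff_isUnit_det _).1 A.isUnit).ne_zero
  have hB : B.val.det ≠ 0 := ((Matrix.isUnit_iff_isUnit_det _).1 B.isUnit).ne_zero
  rw [Matrix.det_smul, Matrix.det_mul, Matrix.det_mul, Fintype.card_fin, mul_comm B.val.det,
    right_eq_mul₀ (mul_ne_zero hA hB)] at hdet
  rcases sq_eq_one_iff.1 hdet with rfl | rfl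
  · exact Or.inl (by rw [hr, one_smul])
  · exact Or.inr (by rw [hr, neg_one_smul])

theorem PGL2.eq_of_orderOf_eq_two {F : Type*} [Field F] (h2 : (2 : F) ≠ 0) {A B : GL (Fin 2) F}
    (hA : orderOf (A : PGL2 F) = 2) (hB : orderOf (B : PGL2 F) = 2)
    (h : A.val * B.val = B.val * A.val) : (A : PGL2 F) = B :=
  PGL2.mk_eq_mk_iff.2 <| exists_smul_eq_of_commute_of_trace_eq_zero h2
    (trace_eq_zero_of_orderOf_eq_two hA) (trace_eq_zero_of_orderOf_eq_two hB) B.ne_zero h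

theorem PGL2.mul_self_eq_of_orderOf_eq_four {F : Type*} [Field F] (h2 : (2 : F) ≠ 0) {i s : PGL2 F}
    (hi : orderOf i = 2) (hs : orderOf s = 4) (h : s * i = i * s) : s * s = i := by
  induction i using QuotientGroup.induction_on with | H A
  induction s using QuotientGroup.induction_on with | H S
  rw [← QuotientGroup.mk_mul]
  refine PGL2.eq_of_orderOf_eq_two h2 ?_ hi ?_
  · rw [QuotientGroup.mk_mul, ← pow_two, orderOf_pow' _ two_ne_zero, hs]
    norm_num
  · rw [Units.val_mul]
    rcases PGL2.mul_eq_or_mul_eq_neg h with h | h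
    · exact Commute.mul_left h h
    · exact commute_mul_of_anticommute h h

theorem PGL2.eq_one_of_commute {F : Type*} [Field F] (h2 : (2 : F) ≠ 0) {A B C : GL (Fin 2) F}
    (hA : orderOf (A : PGL2 F) = 2) (hB : orderOf (B : PGL2 F) = 2) (hAB : (A : PGL2 F) ≠ B)
    (hCA : C.val * A.val = A.val * C.val) (hCB : C.val * B.val = B.val * C.val) :
    (C : PGL2 F) = 1 := by
  by_contra hC
  set D : Matrix (Fin 2) (Fin 2) F := C.val - (C.val.trace / 2) • 1 with hD
  have hD0 : D ≠ 0 := fun h => hC (PGL2.mk_eq_one_iff.2 ⟨_, sub_eq_zero.1 h⟩)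
  have hDtr : D.trace = 0 := by
    simp [hD, Matrix.trace_sub, Matrix.trace_smul, h2]
  have hDA : A.val * D = D * A.val := by simp [hD, mul_sub, sub_mul, hCA]
  have hDB : B.val * D = D * B.val := by simp [hD, mul_sub, sub_mul, hCB]
  obtain ⟨a, ha⟩ := exists_smul_eq_of_commute_of_trace_eq_zero h2
    (trace_eq_zero_of_orderOf_eq_two hA) hDtr hD0 hDA
  refine hAB (eq_of_orderOf_eq_two h2 hA hB ?_)
  rw [ha, smul_mul_assoc, mul_smul_comm, hDB]

theorem PGL2.eq_of_commute_of_commute {F : Type*} [Field F] (h2 : (2 : F) ≠ 0) {i j g : PGL2 F}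
    (hi : orderOf i = 2) (hj : orderOf j = 2) (hij : i ≠ j) (hji : j * i = i * j)
    (hgi : g * i = i * g) (hgj : g * j = j * g) : g = 1 ∨ g = i ∨ g = j ∨ g = i * j := by
  induction i using QuotientGroup.induction_on with | H A
  induction j using QuotientGroup.induction_on with | H B
  induction g using QuotientGroup.induction_on with | H C
  have hAB : B.val * A.val = - (A.val * B.val) := by
    refine (PGL2.mul_eq_or_mul_eq_neg hji).resolve_left fun h => hij ?_
    exact eq_of_orderOf_eq_two h2 hi hj h.symm
  have hBA : A.val * B.val = - (B.val * A.val) := by rw [hAB, neg_neg]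
  have hinv (a : PGL2 F) (ha : orderOf a = 2) : a⁻¹ = a :=
    inv_eq_of_mul_eq_one_left (pow_two a ▸ orderOf_dvd_iff_pow_eq_one.1 ha.dvd)
  rcases PGL2.mul_eq_or_mul_eq_neg hgi with hA | hA <;>
    rcases PGL2.mul_eq_or_mul_eq_neg hgj with hB | hB
  · exact Or.inl (eq_one_of_commute h2 hi hj hij hA hB)
  · have h := eq_one_of_commute (C := C * A) h2 hi hj hij (Commute.mul_left hA rfl)
      (commute_mul_of_anticommute hB hBA)
    rw [QuotientGroup.mk_mul, mul_eq_one_iff_eq_inv, hinv _ hi] at h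
    exact Or.inr (Or.inl h)
  · have h := eq_one_of_commute (C := C * B) h2 hi hj hij (commute_mul_of_anticommute hA hAB)
      (Commute.mul_left hB rfl)
    rw [QuotientGroup.mk_mul, mul_eq_one_iff_eq_inv, hinv _ hj] at h
    exact Or.inr (Or.inr (Or.inl h))
  · have h := eq_one_of_commute (C := C * (A * B)) h2 hi hj hij
      (commute_mul_of_anticommute hA (by rw [Units.val_mul, mul_assoc, hAB, mul_neg]))
      (commute_mul_of_anticommute hB
        (by rw [Units.val_mul, ← mul_assoc, hAB, neg_mul, neg_neg, mul_assoc]))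
    rw [QuotientGroup.mk_mul, QuotientGroup.mk_mul, mul_eq_one_iff_eq_inv, _root_.mul_inv_rev, hinv _ hi,
      hinv _ hj, hji] at h
    exact Or.inr (Or.inr (Or.inr h))

theorem nonempty_mulEquiv_perm_of_isComplement' {G : Type*} [Group G] [Finite G]
    (V L : Subgroup G) [V.Normal] (hV : Nat.card V = 4)
    (hcent : Subgroup.centralizer (V : Set G) ≤ V) (hVL : V.IsComplement' L)
    (hL : 6 ∣ Nat.card L) : Nonempty (G ≃* Equiv.Perm (Fin 4)) := by
  have hcore : L.normalCore = ⊥ := by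
    have hdisj : Disjoint V L.normalCore := hVL.disjoint.mono_right L.normalCore_le
    rw [eq_bot_iff]
    intro g hg
    refine (hdisj.le_bot ⟨hcent fun v hv => ?_, hg⟩)
    exact Subgroup.commute_of_normal_of_disjoint V L.normalCore inferInstance inferInstance
      hdisj v g hv hg
  have hinj : Function.Injective (MulAction.toPermHom G (G ⧸ L)) := by
    rw [← MonoidHom.ker_eq_bot_iff, ← Subgroup.normalCore_eq_ker, hcore]
  have hindex : Nat.card (G ⧸ L) = 4 := hVL.index_eq_card.trans hV
  have e : G ⧸ L ≃ Fin 4 := Finite.equivFinOfCardEq hindex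
  let f : G →* Equiv.Perm (Fin 4) := e.permCongrHom.toMonoidHom.comp (MulAction.toPermHom G (G ⧸ L))
  have hf : Function.Injective f := e.permCongrHom.injective.comp hinj
  have hcard : Nat.card (Equiv.Perm (Fin 4)) = 24 := by
    rw [Nat.card_perm, Nat.card_fin]; rfl
  have hG : Nat.card (Equiv.Perm (Fin 4)) ≤ Nat.card G := by
    rw [hcard, ← hVL.card_mul_card, hV]
    have := Nat.le_of_dvd Nat.card_pos hL
    omega
  exact ⟨MulEquiv.ofBijective f (hf.bijective_of_nat_card_le hG)⟩

theorem nonempty_mulEquiv_perm_of_closure_eq_top {G : Type*} [Group G] [Finite G] {i j x s : G}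
    (hi : i * i = 1) (hj : j * j = 1) (hi1 : i ≠ 1) (hij : i ≠ j) (hji : j * i = i * j)
    (hx : orderOf x = 3) (hxi : x * i = j * x) (hxj : x * j = i * j * x)
    (hs : s * s = i) (hsj : s * j = i * j * s)
    (hcent : ∀ g : G, g * i = i * g → g * j = j * g → g = 1 ∨ g = i ∨ g = j ∨ g = i * j)
    (htop : Subgroup.closure {i, j, x, s} = ⊤) : Nonempty (G ≃* Equiv.Perm (Fin 4)) := by
  have hsi : s * i = i * s := by rw [← hs, mul_assoc]
  have hii (g : G) : i * (i * g) = g := by rw [← mul_assoc, hi, one_mul]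
  have hjj (g : G) : j * (j * g) = g := by rw [← mul_assoc, hj, one_mul]
  have hjia (g : G) : j * (i * g) = i * (j * g) := by rw [← mul_assoc, hji, mul_assoc]
  have hxia (g : G) : x * (i * g) = j * (x * g) := by rw [← mul_assoc, hxi, mul_assoc]
  have hxja (g : G) : x * (j * g) = i * (j * (x * g)) := by
    rw [← mul_assoc, hxj, mul_assoc, mul_assoc]
  have hsia (g : G) : s * (i * g) = i * (s * g) := by rw [← mul_assoc, hsi, mul_assoc]
  have hsja (g : G) : s * (j * g) = i * (j * (s * g)) := by
    rw [← mul_assoc, hsj, mul_assoc, mul_assoc]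
  have hj1 : j ≠ 1 := by rintro rfl; apply hi1; simpa using hxi
  have hij1 : i * j ≠ 1 := fun h => hij (by rw [mul_eq_one_iff_eq_inv.1 h, inv_eq_of_mul_eq_one_left hj])
  set V : Subgroup G := Subgroup.centralizer {i, j} with hVdef
  have hmemV (g : G) : g ∈ V ↔ g = 1 ∨ g = i ∨ g = j ∨ g = i * j := by
    constructor
    · intro hg
      rw [hVdef, Subgroup.mem_centralizer_iff] at hg
      exact hcent g (hg i (by simp)).symm (hg j (by simp)).symm
    · rw [hVdef, Subgroup.mem_centralizer_iff]
      rintro (rfl | rfl | rfl | rfl) h (rfl | rfl) <;> simp [mul_assoc, hji, hjia, hi, hj, hii]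
  have hVset : (V : Set G) = {1, i, j, i * j} := by ext g; simpa using hmemV g
  have hcardV : Nat.card V = 4 := by
    have h : (V : Set G).ncard = 4 := by
      rw [hVset, Set.ncard_insert_of_notMem, Set.ncard_insert_of_notMem, Set.ncard_pair]
      · simpa using hi1
      · simp [hij, hj1]
      · simp [hi1.symm, hj1.symm, hij1.symm]
    exact h
  have hVn : V.Normal := by
    rw [← Subgroup.normalizer_eq_top_iff, eq_top_iff, ← htop, Subgroup.closure_le]
    have key (y : G) (hyi : ∃ v ∈ V, y * i = v * y) (hyj : ∃ v ∈ V, y * j = v * y) :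
        y ∈ Subgroup.normalizer (V : Set G) := by
      obtain ⟨a, ha, hya⟩ := hyi
      obtain ⟨b, hb, hyb⟩ := hyj
      apply Subgroup.mem_normalizer_fintype
      rw [hVset]
      rintro g (rfl | rfl | rfl | rfl) <;> rw [← hVset]
      · simp
      · simpa [hya]
      · simpa [hyb]
      · rw [← mul_assoc, hya, mul_assoc a, hyb]
        simpa [← mul_assoc] using mul_mem ha hb
    rintro y (rfl | rfl | rfl | rfl) <;> apply key <;>
      simp [hmemV, hi, hj, hji, hxi, hxj, hsi, hsj]
  obtain ⟨w, hw, hsx⟩ : ∃ w ∈ V, s * x = w * x⁻¹ * s := by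
    have hsi' (g : G) : s⁻¹ * (i * g) = i * (s⁻¹ * g) := by
      rw [inv_mul_eq_iff_eq_mul, hsia, mul_inv_cancel_left]
    have hsj' (g : G) : s⁻¹ * (j * g) = i * (j * (s⁻¹ * g)) := by
      rw [inv_mul_eq_iff_eq_mul, hsia, hsja, hii, mul_inv_cancel_left]
    refine ⟨s * x * s⁻¹ * x, (hmemV _).2 (hcent _ ?_ ?_), by group⟩
    · simp only [mul_assoc, hxi, hxia, hxja, hsia, hsj', hjj, hjia]
    · simp only [mul_assoc, hxj, hxja, hsia, hsja, hsi', hsj', hii]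
  have hxV (v : G) (hv : v ∈ V) (h : v * x = x * v) : v = 1 := by
    rcases (hmemV v).1 hv with rfl | rfl | rfl | rfl
    · rfl
    · rw [hxi, mul_left_inj] at h; exact absurd h hij
    · rw [hxj, mul_left_inj] at h; simp at h; exact absurd h hi1
    · rw [← mul_assoc, hxi, mul_assoc j, hxj] at h
      simp [mul_assoc, hjia, hjj] at h
      exact absurd h hj1
  obtain ⟨u, hu, hux⟩ : ∃ u ∈ V, u * s * x = x⁻¹ * (u * s) := by
    have key (u : G) (hu : u ∈ V) (h : x * (u * w) = u * x) :
        ∃ u ∈ V, u * s * x = x⁻¹ * (u * s) := by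
      refine ⟨u, hu, ?_⟩
      rw [eq_inv_mul_iff_mul_eq, mul_assoc u, hsx]
      simp only [← mul_assoc] at h ⊢
      rw [h, mul_inv_cancel_right]
    rcases (hmemV w).1 hw with h | h | h | h
    · exact key 1 (one_mem V) (by simp [h])
    · refine key (i * j) ((hmemV _).2 (by simp)) ?_
      simp only [h, mul_assoc, hxi, hxia, hxja, hjj, hjia]
    · refine key i ((hmemV _).2 (by simp)) ?_
      simp only [h, mul_assoc, hxj, hxia, hjj, hjia]
    · refine key j ((hmemV _).2 (by simp)) ?_
      simp only [h, mul_assoc, hxj, hxia, hxja, hii, hjj, hjia]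
  set t := u * s with ht
  have htt : t * t = 1 := by
    apply hxV
    · have h : t * t = u * (s * u * s⁻¹) * i := by rw [ht, ← hs]; group
      rw [h]
      exact mul_mem (mul_mem hu (hVn.conj_mem u hu s)) ((hmemV i).2 (by simp))
    · have h : x * t = t * x⁻¹ := by
        rw [eq_mul_inv_iff_mul_eq, mul_assoc, hux, mul_inv_cancel_left]
      rw [mul_assoc, hux, ← mul_assoc, ← h, mul_assoc]
  have ht1 : t ≠ 1 := by
    intro h
    have hsV : s ∈ V := by
      rw [← inv_eq_of_mul_eq_one_right h]
      exact inv_mem hu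
    rw [hVdef, Subgroup.mem_centralizer_iff] at hsV
    have hjs := hsV j (by simp)
    rw [hsj, mul_left_inj] at hjs
    exact hi1 (right_eq_mul.1 hjs)
  let L : Subgroup G := Subgroup.normalizer (Subgroup.zpowers x : Set G)
  have hxL : x ∈ L := Subgroup.le_normalizer (Subgroup.mem_zpowers x)
  have htL : t ∈ L := by
    apply Subgroup.mem_normalizer_fintype
    rintro _ ⟨n, rfl⟩
    rw [← conj_zpow, hux, mul_inv_cancel_right]
    exact zpow_mem (inv_mem (Subgroup.mem_zpowers x)) n
  have hdisj : Disjoint V L := by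
    have hVx : Disjoint V (Subgroup.zpowers x) := by
      apply Subgroup.disjoint_of_coprime_natCard
      rw [hcardV, Nat.card_zpowers, hx]
      norm_num
    rw [Subgroup.disjoint_def]
    intro v hv hvL
    apply hxV v hv
    rw [← mul_inv_eq_one, _root_.mul_inv_rev, ← mul_assoc]
    apply Subgroup.disjoint_def.1 hVx
    · simpa only [mul_assoc] using mul_mem hv (hVn.conj_mem _ (inv_mem hv) x)
    · exact mul_mem ((Subgroup.mem_normalizer_iff.1 hvL x).1 (Subgroup.mem_zpowers x))
        (inv_mem (Subgroup.mem_zpowers x))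
  have hsup : V ⊔ L = ⊤ := by
    rw [eq_top_iff, ← htop, Subgroup.closure_le]
    have hVle : V ≤ V ⊔ L := le_sup_left
    have hLle : L ≤ V ⊔ L := le_sup_right
    rintro y (rfl | rfl | rfl | rfl)
    · exact hVle ((hmemV _).2 (by simp))
    · exact hVle ((hmemV _).2 (by simp))
    · exact hLle hxL
    · have := mul_mem (hVle (inv_mem hu)) (hLle htL)
      simpa [ht] using this
  refine nonempty_mulEquiv_perm_of_isComplement' V L hcardV ?_ ?_ ?_
  · exact Subgroup.centralizer_le (by simp [hVset, Set.insert_subset_iff])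
  · refine Subgroup.isComplement'_of_disjoint_and_mul_eq_univ hdisj ?_
    rw [← Subgroup.normal_mul, hsup, Subgroup.coe_top]
  · refine Nat.Coprime.mul_dvd_of_dvd_of_dvd (m := 2) (n := 3) (by norm_num) ?_ ?_
    · rw [← orderOf_eq_prime (p := 2) (by rwa [pow_two]) ht1, ← Subgroup.orderOf_mk t htL]
      exact orderOf_dvd_natCard _
    · rw [← hx, ← Subgroup.orderOf_mk x hxL]
      exact orderOf_dvd_natCard _


/-- Construction of `Sym₄` in `G = PGL₂(𝔽_q)`, `q ≥ 5` an odd prime power: with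
`d = q - ε` (`ε = ±1` chosen so `4 ∣ d`), an involution `i` with cyclic torus
`T ≤ C_G(i)` of cardinality `d`, an involution `j` inverting `T` with
`|C_G(j)| = 2d`, an element `x` of order `3` permuting `i, j, i*j`, and `s ∈ T`
of order `4`, the subgroup `⟨i, j, x, s⟩` is isomorphic to `Sym₄`. -/
theorem sym4_in_PGL2
    (p : ℕ) [Fact p.Prime] (hp : Odd p) (k : ℕ) (hk : 0 < k)
    (q : ℕ) (hq : q = p ^ k) (hq5 : 5 ≤ q)
    (d : ℕ) (hd : (q % 4 = 1 ∧ d = q - 1) ∨ (q % 4 = 3 ∧ d = q + 1))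
    (i : PGL2 (GaloisField p k)) (hi : orderOf i = 2)
    (T : Subgroup (PGL2 (GaloisField p k)))
    (hTle : T ≤ Subgroup.centralizer {i}) (hTcyc : IsCyclic T)
    (hTcard : Nat.card T = d)
    (j : PGL2 (GaloisField p k)) (hj : orderOf j = 2)
    (hjinv : ∀ t ∈ T, j⁻¹ * t * j = t⁻¹)
    (hjcent : Nat.card (Subgroup.centralizer {j} : Subgroup (PGL2 (GaloisField p k)))
      = 2 * d)
    (x : PGL2 (GaloisField p k)) (hx : orderOf x = 3)
    (hxi : x⁻¹ * i * x = i * j) (hxj : x⁻¹ * j * x = i)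
    (s : PGL2 (GaloisField p k)) (hsT : s ∈ T) (hs : orderOf s = 4) :
    Nonempty ((Subgroup.closure {i, j, x, s} : Subgroup (PGL2 (GaloisField p k)))
      ≃* Equiv.Perm (Fin 4)) := by
  have h2 : (2 : GaloisField p k) ≠ 0 := by
    have hp2 : p ≠ 2 := by rintro rfl; exact absurd hp (by decide)
    exact Ring.two_ne_zero (by rwa [ringChar.eq (GaloisField p k) p])
  have hi2 : i * i = 1 := pow_two i ▸ orderOf_dvd_iff_pow_eq_one.1 hi.dvd
  have hj2 : j * j = 1 := pow_two j ▸ orderOf_dvd_iff_pow_eq_one.1 hj.dvd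
  have hi1 : i ≠ 1 := by rintro rfl; simp at hi
  have hij : i ≠ j := by
    rintro rfl
    rw [hi2, mul_assoc, inv_mul_eq_one, right_eq_mul] at hxi
    exact hi1 hxi
  have hsi : s * i = i * s := Subgroup.mem_centralizer_singleton_iff.1 (hTle hsT)
  have hss : s * s = i := PGL2.mul_self_eq_of_orderOf_eq_four h2 hi hs hsi
  have hji : j * i = i * j := by
    have h := hjinv i (hss ▸ mul_mem hsT hsT)
    rwa [inv_eq_of_mul_eq_one_left hi2, mul_assoc, inv_mul_eq_iff_eq_mul, eq_comm] at h
  have hsj : s * j = i * j * s := by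
    have h := hjinv s hsT
    rw [mul_assoc, inv_mul_eq_iff_eq_mul] at h
    rw [h, ← hji, mul_assoc,
      inv_eq_of_mul_eq_one_left (show i * s * s = 1 by rw [mul_assoc, hss, hi2])]
  have hxi' : x * i = j * x := by
    rw [← hxj]; group
  have hxj' : x * j = i * j * x := by
    have h : i * x = x * (i * j) := by rw [← hxi]; group
    rw [← hji, mul_assoc, h, ← mul_assoc x, hxi', ← mul_assoc, ← mul_assoc, hj2, one_mul]
  have htop := Subgroup.closure_closure_coe_preimage (k := {i, j, x, s})
  set H := Subgroup.closure {i, j, x, s} with hH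
  have hiH : i ∈ H := Subgroup.subset_closure (by simp)
  have hjH : j ∈ H := Subgroup.subset_closure (by simp)
  have hxH : x ∈ H := Subgroup.subset_closure (by simp)
  have hsH : s ∈ H := Subgroup.subset_closure (by simp)
  refine nonempty_mulEquiv_perm_of_closure_eq_top (i := (⟨i, hiH⟩ : H)) (j := ⟨j, hjH⟩)
    (x := ⟨x, hxH⟩) (s := ⟨s, hsH⟩) (Subtype.ext hi2) (Subtype.ext hj2)
    (fun h => hi1 (congrArg Subtype.val h)) (fun h => hij (congrArg Subtype.val h))
    (Subtype.ext hji) (by rwa [Subgroup.orderOf_mk]) (Subtype.ext hxi') (Subtype.ext hxj')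
    (Subtype.ext hss) (Subtype.ext hsj) (fun g hgi hgj => ?_) ?_
  · simpa only [Subtype.ext_iff, Subgroup.coe_one, Subgroup.coe_mul] using PGL2.eq_of_commute_of_commute h2 hi hj hij hji
      (congrArg Subtype.val hgi) (congrArg Subtype.val hgj)
  · rw [← htop]
    congr 1
    ext g
    simp [Subtype.ext_iff]
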